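/- Let K be a field of characteristic zero and let F be a two-dimensional invariant subspace of K[Σ₃] containing V = Id − τ₁₂ − τ₁₃ − τ₂₃ + c₁ + c₂. Then F is the linear span of V and W = Id + τ₁₂ + τ₁₃ + τ₂₃ + c₁ + c₂, and F = F_v for v = Id + c₁ + c₂. -/

import Mathlib

open scoped TensorProduct

abbrev S3 := Equiv.Perm (Fin 3)

def t12 : S3 := Equiv.swap 0 1
def t13 : S3 := Equiv.swap 0 2
def t23 : S3 := Equiv.swap 1 2
def c1 : S3 := Equiv.swap 0 2 * Equiv.swap 0 1
def c2 : S3 := c1 * c1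

abbrev GA (K : Type*) [Field K] := S3 → K

def act {K : Type*} [Field K] (σ : S3) (v : GA K) : GA K := fun τ => v (σ * τ)

def Fv (K : Type*) [Field K] (v : GA K) : Submodule K (GA K) :=
  Submodule.span K (Set.range fun σ => act σ v)

def elt {K : Type*} [Field K] (a₁ a₂ a₃ a₄ a₅ a₆ : K) : GA K := fun σ =>
  (if σ = 1 then a₁ else 0) + (if σ = t12 then a₂ else 0) + (if σ = t13 then a₃ else 0) +
  (if σ = t23 then a₄ else 0) + (if σ = c1 then a₅ else 0) + (if σ = c2 then a₆ else 0)

def Vv (K : Type*) [Field K] : GA K := elt 1 (-1) (-1) (-1) 1 1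
def Wv (K : Type*) [Field K] : GA K := elt 1 1 1 1 1 1

def assoc {K A : Type*} [Field K] [AddCommGroup A] [Module K A]
    (μ : A →ₗ[K] A →ₗ[K] A) (x y z : A) : A := μ (μ x y) z - μ x (μ y z)

def bra {K A : Type*} [Field K] [AddCommGroup A] [Module K A]
    (μ : A →ₗ[K] A →ₗ[K] A) (x y : A) : A := μ x y - μ y x

def LieAdmissible {K A : Type*} [Field K] [AddCommGroup A] [Module K A]
    (μ : A →ₗ[K] A →ₗ[K] A) : Prop :=
  ∀ x y z : A, bra μ x (bra μ y z) + bra μ y (bra μ z x) + bra μ z (bra μ x y) = 0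

def Lterm {K A : Type*} [Field K] [AddCommGroup A] [Module K A]
    (μ : A →ₗ[K] A →ₗ[K] A) (σ : S3) (x : Fin 3 → A) : A :=
  μ (μ (x (σ⁻¹ 0)) (x (σ⁻¹ 1))) (x (σ⁻¹ 2))

def Rterm {K A : Type*} [Field K] [AddCommGroup A] [Module K A]
    (μ : A →ₗ[K] A →ₗ[K] A) (σ : S3) (x : Fin 3 → A) : A :=
  μ (x (σ⁻¹ 0)) (μ (x (σ⁻¹ 1)) (x (σ⁻¹ 2)))

def assocPhi {K A : Type*} [Field K] [AddCommGroup A] [Module K A]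
    (μ : A →ₗ[K] A →ₗ[K] A) (v : GA K) : Prop :=
  ∀ x : Fin 3 → A, ∑ σ : S3, v σ • assoc μ (x (σ⁻¹ 0)) (x (σ⁻¹ 1)) (x (σ⁻¹ 2)) = 0

theorem perm_fin_three_cases (σ : S3) :
    σ = 1 ∨ σ = t12 ∨ σ = t13 ∨ σ = t23 ∨ σ = c1 ∨ σ = c2 := by
  revert σ; decide

theorem act_act {K : Type*} [Field K] (σ τ : S3) (v : GA K) :
    act σ (act τ v) = act (τ * σ) v := by
  funext ρ; simp [act, mul_assoc]

theorem act_one {K : Type*} [Field K] (v : GA K) : act 1 v = v := by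
  funext ρ; simp [act]

theorem act_smul_add_smul {K : Type*} [Field K] (σ : S3) (a b : K) (v w : GA K) :
    act σ (a • v + b • w) = a • act σ v + b • act σ w := rfl

theorem act_t12_Vv (K : Type*) [Field K] : act t12 (Vv K) = -Vv K := by
  funext σ
  rcases perm_fin_three_cases σ with rfl | rfl | rfl | rfl | rfl | rfl <;>
    simp +decide [act, Vv, elt]

theorem act_c1_Vv (K : Type*) [Field K] : act c1 (Vv K) = Vv K := by
  funext σ
  rcases perm_fin_three_cases σ with rfl | rfl | rfl | rfl | rfl | rfl <;>
    simp +decide [act, Vv, elt]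

theorem Vv_eq (K : Type*) [Field K] :
    Vv K = elt 1 0 0 0 1 1 - act t12 (elt 1 0 0 0 1 1) := by
  funext σ
  rcases perm_fin_three_cases σ with rfl | rfl | rfl | rfl | rfl | rfl <;>
    simp +decide [act, Vv, elt]

theorem Wv_eq (K : Type*) [Field K] :
    Wv K = elt 1 0 0 0 1 1 + act t12 (elt 1 0 0 0 1 1) := by
  funext σ
  rcases perm_fin_three_cases σ with rfl | rfl | rfl | rfl | rfl | rfl <;>
    simp +decide [act, Wv, elt]

theorem mem_span_Vv_Wv_of_act_c1_eq {K : Type*} [Field K] [CharZero K] {x : GA K}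
    (hx : act c1 x = x) : x ∈ Submodule.span K ({Vv K, Wv K} : Set (GA K)) := by
  have h (σ : S3) : x (c1 * σ) = x σ := congrFun hx σ
  have h1 : x c1 = x 1 := h 1
  have h2 : x c2 = x 1 := (h c1).trans h1
  have h3 : x t13 = x t12 := by
    rw [← h t12]; congr 1; decide
  have h4 : x t23 = x t12 := by
    rw [← h3, ← h t13]; congr 1; decide
  refine Submodule.mem_span_pair.2 ⟨(x 1 - x t12) / 2, (x 1 + x t12) / 2, ?_⟩
  funext σ
  rcases perm_fin_three_cases σ with rfl | rfl | rfl | rfl | rfl | rfl <;>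
    simp +decide [Vv, Wv, elt, h1, h2, h3, h4] <;> ring

/-- Modulo the sign vector `Vv`, a line on which `Σ₃` acts has trivial action of the 3-cycles. -/
theorem act_c1_eq_of_mod_Vv {K : Type*} [Field K] [CharZero K] {x : GA K}
    (hli : LinearIndependent K ![Vv K, x]) {p q r u : K}
    (ht : q • Vv K + p • x = act t12 x) (hc : u • Vv K + r • x = act c1 x) :
    act c1 x = x := by
  rw [LinearIndependent.pair_iff] at hli
  have htt : act t12 (act t12 x) = x := by
    rw [act_act, show t12 * t12 = 1 by decide, act_one]
  have hccc : act c1 (act c1 (act c1 x)) = x := by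
    rw [act_act, act_act, show c1 * (c1 * c1) = 1 by decide, act_one]
  have hctct : act c1 (act t12 (act c1 (act t12 x))) = x := by
    rw [act_act, act_act, act_act, show t12 * (c1 * (t12 * c1)) = 1 by decide, act_one]
  have hneg : act c1 (-Vv K) = -Vv K := congrArg Neg.neg (act_c1_Vv K)
  simp only [← ht, ← hc, act_smul_add_smul, act_t12_Vv, act_c1_Vv, hneg] at htt hccc hctct
  have hp := (hli (-q + p * q) (p ^ 2 - 1) (by linear_combination (norm := module) htt)).2
  obtain ⟨hu, hr⟩ := hli (u + r * u + r ^ 2 * u) (r ^ 3 - 1)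
    (by linear_combination (norm := module) hccc)
  have hpr := (hli (-q + p * (-u + r * q) + p * r * p * u) (p ^ 2 * r ^ 2 - 1)
    (by linear_combination (norm := module) hctct)).2
  have hr1 : r = 1 := by linear_combination hr - r * hpr + r ^ 3 * hp
  have hu0 : u = 0 := by
    subst hr1
    have h3 : (3 : K) * u = 0 := by linear_combination hu
    simpa using h3
  rw [← hc, hr1, hu0]
  simp

theorem stmt9 (K : Type*) [Field K] [CharZero K] (F : Submodule K (GA K))
    (hinv : ∀ (σ : S3) (x : GA K), x ∈ F → act σ x ∈ F)
    (hdim : Module.finrank K F = 2) (hV : Vv K ∈ F) :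
    F = Submodule.span K ({Vv K, Wv K} : Set (GA K)) ∧ F = Fv K (elt 1 0 0 0 1 1) := by
  have hx : ∃ x ∈ F, x ∉ Submodule.span K {Vv K} := by
    by_contra! h
    have h1 := Submodule.finrank_mono (show F ≤ Submodule.span K {Vv K} from h)
    have h2 := finrank_span_le_card (R := K) ({Vv K} : Set (GA K))
    simp at h2
    omega
  obtain ⟨x, hxF, hx⟩ := hx
  have hV0 : Vv K ≠ 0 := fun h => by
    simpa +decide [Vv, elt] using congrFun h 1
  have hli : LinearIndependent K ![Vv K, x] :=
    (LinearIndependent.pair_iff' hV0).2 fun a ha => hx (Submodule.mem_span_singleton.2 ⟨a, ha⟩)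
  have hF : Submodule.span K {Vv K, x} = F := by
    refine Submodule.eq_of_le_of_finrank_eq
      (Submodule.span_le.2 (Set.pair_subset hV hxF)) ?_
    have := finrank_span_eq_card hli
    rw [Matrix.range_cons_cons_empty] at this
    rw [this, hdim, Fintype.card_fin]
  have hmod (σ : S3) : ∃ q p : K, q • Vv K + p • x = act σ x :=
    Submodule.mem_span_pair.1 (hF ▸ hinv σ x hxF)
  obtain ⟨q, p, ht⟩ := hmod t12
  obtain ⟨u, r, hc⟩ := hmod c1
  have hxVW := mem_span_Vv_Wv_of_act_c1_eq (act_c1_eq_of_mod_Vv hli ht hc)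
  have hFVW : F = Submodule.span K ({Vv K, Wv K} : Set (GA K)) := by
    refine Submodule.eq_of_le_of_finrank_le ?_ ?_
    · rw [← hF, Submodule.span_le]
      exact Set.pair_subset (Submodule.subset_span (by simp)) hxVW
    · classical
      rw [hdim]
      have := finrank_span_finset_le_card (R := K) ({Vv K, Wv K} : Finset (GA K))
      rw [Finset.coe_pair] at this
      exact this.trans Finset.card_le_two
  refine ⟨hFVW, le_antisymm ?_ ?_⟩
  · have hmem (σ : S3) : act σ (elt 1 0 0 0 1 1) ∈ Fv K (elt 1 0 0 0 1 1) :=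
      Submodule.subset_span ⟨σ, rfl⟩
    have h1 := hmem 1
    rw [act_one] at h1
    rw [hFVW, Submodule.span_le]
    refine Set.pair_subset ?_ ?_
    · rw [SetLike.mem_coe, Vv_eq]
      exact sub_mem h1 (hmem t12)
    · rw [SetLike.mem_coe, Wv_eq]
      exact add_mem h1 (hmem t12)
  · refine Submodule.span_le.2 ?_
    rintro _ ⟨σ, rfl⟩
    refine hinv σ _ ?_
    rw [hFVW]
    apply mem_span_Vv_Wv_of_act_c1_eq
    funext σ
    rcases perm_fin_three_cases σ with rfl | rfl | rfl | rfl | rfl | rfl <;>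
      simp +decide [act, elt]
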